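/- Let X be a partial EFX allocation for n agents whose valuations are non-degenerate and cancelable, in which at least n−1 items are unallocated, and let G be the directed multigraph on the agents whose edges are the envy edges and the g-champion edges for every unallocated item g. If G contains no basic PI cycle, then the number of unallocated items is exactly n−1, G contains no envy edges, and there is a single cyclic ordering of the n agents such that, for every unallocated item g, the g-champion edges of G are exactly the n edges from each agent to its successor in this cyclic ordering (so G is a union of n−1 parallel Hamiltonian cycles, one per unallocated item). -/

import Mathlib

namespace FairDivision

open Finset

/-- A valuation: nonnegative, zero on the empty set, monotone. -/
def IsValuation {ι : Type*} (v : Finset ι → ℝ) : Prop :=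
  v ∅ = 0 ∧ (∀ S : Finset ι, 0 ≤ v S) ∧ ∀ ⦃S T : Finset ι⦄, S ⊆ T → v S ≤ v T

/-- `v` is cancelable: `v (S ∪ {g}) > v (T ∪ {g})` implies `v S > v T`. -/
def Cancelable {ι : Type*} [DecidableEq ι] (v : Finset ι → ℝ) : Prop :=
  ∀ S T : Finset ι, ∀ g : ι, g ∉ S → g ∉ T →
    v (insert g S) > v (insert g T) → v S > v T

/-- `v` is non-degenerate: distinct bundles have distinct values. -/
def NonDegenerate {ι : Type*} (v : Finset ι → ℝ) : Prop :=
  ∀ S T : Finset ι, S ≠ T → v S ≠ v T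

/-- `v'` respects `v`: every strict inequality of `v` is a strict inequality of `v'`. -/
def Respects {ι : Type*} (v' v : Finset ι → ℝ) : Prop :=
  ∀ S T : Finset ι, v S > v T → v' S > v' T

/-- `v` is a nice cancelable valuation: cancelable, and some non-degenerate
cancelable valuation respects it. -/
def NiceCancelable {ι : Type*} [DecidableEq ι] (v : Finset ι → ℝ) : Prop :=
  Cancelable v ∧ ∃ v' : Finset ι → ℝ,
    IsValuation v' ∧ NonDegenerate v' ∧ Cancelable v' ∧ Respects v' v

/-- A partial allocation: the bundles are pairwise disjoint. -/
def IsPartialAlloc {ι : Type*} {n : ℕ} (X : Fin n → Finset ι) : Prop :=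
  ∀ i j : Fin n, i ≠ j → Disjoint (X i) (X j)

/-- The set of unallocated items. -/
def unalloc {ι : Type*} [DecidableEq ι] [Fintype ι] {n : ℕ}
    (X : Fin n → Finset ι) : Finset ι :=
  Finset.univ \ Finset.univ.biUnion X

/-- Agent `i` envies the set `S`. -/
def EnviesSet {ι : Type*} {n : ℕ} (v : Fin n → Finset ι → ℝ) (X : Fin n → Finset ι)
    (i : Fin n) (S : Finset ι) : Prop :=
  v i (X i) < v i S

/-- Agent `i` strongly envies the set `S`. -/
def StrongEnviesSet {ι : Type*} [DecidableEq ι] {n : ℕ} (v : Fin n → Finset ι → ℝ)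
    (X : Fin n → Finset ι) (i : Fin n) (S : Finset ι) : Prop :=
  ∃ h ∈ S, v i (X i) < v i (S.erase h)

/-- The allocation is EFX: no agent strongly envies another agent's bundle. -/
def IsEFX {ι : Type*} [DecidableEq ι] {n : ℕ} (v : Fin n → Finset ι → ℝ)
    (X : Fin n → Finset ι) : Prop :=
  ∀ i j : Fin n, i ≠ j → ¬ StrongEnviesSet v X i (X j)

/-- `Y` Pareto dominates `X`. -/
def ParetoDominates {ι : Type*} {n : ℕ} (v : Fin n → Finset ι → ℝ)
    (Y X : Fin n → Finset ι) : Prop :=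
  (∀ i, v i (X i) ≤ v i (Y i)) ∧ ∃ i, v i (X i) < v i (Y i)

/-- `Y` dominates `X` lexicographically with respect to the ordering `a` of the agents. -/
def Dominates {ι : Type*} {n : ℕ} (v : Fin n → Finset ι → ℝ) (a : Fin n → Fin n)
    (Y X : Fin n → Finset ι) : Prop :=
  ∃ k : Fin n, (∀ j : Fin n, j < k → v (a j) (Y (a j)) = v (a j) (X (a j))) ∧
    v (a k) (X (a k)) < v (a k) (Y (a k))

/-- Agent `i` is a most envious agent of the set `S`: there is `T ⊆ S` that `i`
envies and that no agent strongly envies.  (`S \ T` is a corresponding discard set.) -/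
def MostEnvious {ι : Type*} [DecidableEq ι] {n : ℕ} (v : Fin n → Finset ι → ℝ)
    (X : Fin n → Finset ι) (i : Fin n) (S : Finset ι) : Prop :=
  ∃ T ⊆ S, EnviesSet v X i T ∧ ∀ j : Fin n, ¬ StrongEnviesSet v X j T

/-- `i` champions `j` with respect to the item `g`:  `i` is a most envious agent
of `X j ∪ {g}`. -/
def ChampG {ι : Type*} [DecidableEq ι] {n : ℕ} (v : Fin n → Finset ι → ℝ)
    (X : Fin n → Finset ι) (g : ι) (i j : Fin n) : Prop :=
  MostEnvious v X i (insert g (X j))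

/-- `i` champions `j` with respect to `(H | S)`:  `H ⊆ M \ X j`, `S ⊆ X j`, and `i`
is a most envious agent of `(X j \ S) ∪ H`. -/
def GenChamp {ι : Type*} [DecidableEq ι] {n : ℕ} (v : Fin n → Finset ι → ℝ)
    (X : Fin n → Finset ι) (i j : Fin n) (H S : Finset ι) : Prop :=
  Disjoint H (X j) ∧ S ⊆ X j ∧ MostEnvious v X i ((X j \ S) ∪ H)

/-- A basic PI cycle in the graph of envy edges and `g`-champion edges (for
unallocated `g`): a cycle of distinct agents whose edges are labelled either by
`none` (an envy edge) or by `some g` (a `g`-champion edge for an unallocated item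
`g`), such that every unallocated item labels at most one edge of the cycle. -/
structure BasicPICycle {ι : Type*} [DecidableEq ι] [Fintype ι] {n : ℕ}
    (v : Fin n → Finset ι → ℝ) (X : Fin n → Finset ι) where
  k : ℕ
  kpos : 0 < k
  a : ZMod k → Fin n
  inj : Function.Injective a
  lab : ZMod k → Option ι
  edge_envy : ∀ t : ZMod k, lab t = none → EnviesSet v X (a t) (X (a (t + 1)))
  edge_champ : ∀ (t : ZMod k) (g : ι), lab t = some g →
    g ∈ unalloc X ∧ ChampG v X g (a t) (a (t + 1))
  once : ∀ (g : ι) (t s : ZMod k), lab t = some g → lab s = some g → t = s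

/-- The coloured edges `R` admit no nonempty set of vertices in `V` that is closed under some
choice of in-edges with pairwise distinct colours from `C`.  On finite digraphs this says that
there is no rainbow cycle. -/
def NoRainbow {α κ : Type*} (R : κ → α → α → Prop) (C : Finset κ) (V : Finset α) : Prop :=
  ∀ S ⊆ V, S.Nonempty → ∀ (p : α → α) (σ : α → κ),
    (∀ s ∈ S, p s ∈ S ∧ σ s ∈ C ∧ R (σ s) (p s) s) → ¬ Set.InjOn σ (S : Set α)

namespace NoRainbow

variable {α κ : Type*} {R : κ → α → α → Prop} {C : Finset κ} {V : Finset α}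

lemma not_loop (h : NoRainbow R C V) {c : κ} (hc : c ∈ C) {x : α} (hx : x ∈ V) :
    ¬ R c x x := by
  intro hR
  refine h {x} (by simpa using hx) (by simp) (fun _ => x) (fun _ => c) ?_ (by simp)
  simpa using ⟨hc, hR⟩

lemma not_two_cycle [DecidableEq α] (h : NoRainbow R C V) {c d : κ} (hc : c ∈ C) (hd : d ∈ C)
    (hcd : c ≠ d) {x y : α} (hx : x ∈ V) (hy : y ∈ V) (hxy : R c x y) : ¬ R d y x := by
  intro hyx
  have hne : x ≠ y := by
    rintro rfl
    exact h.not_loop hc hx hxy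
  refine h {x, y} (by grind) (by simp) (fun z => if z = x then y else x)
    (fun z => if z = x then d else c) (by grind) ?_
  intro a ha b hb hab
  simp only [Finset.coe_insert, Finset.coe_singleton, Set.mem_insert_iff,
    Set.mem_singleton_iff] at ha hb
  grind

/-- Contracting an edge `u → v` of colour `c` onto `u` and removing the colour `c` creates no
rainbow cycle. -/
lemma contract [DecidableEq α] [DecidableEq κ] (h : NoRainbow R C V) {c : κ} (hc : c ∈ C)
    {u v : α} (hv : v ∈ V) (huv : R c u v) :
    NoRainbow (fun d a b => R d a b ∨ a = u ∧ R d v b) (C.erase c) (V.erase v) := by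
  classical
  intro S hS hne p σ hp hσ
  have hvS : v ∉ S := fun hvS => by simpa using hS hvS
  have hSV : S ⊆ V := hS.trans (Finset.erase_subset _ _)
  by_cases hu : u ∈ S
  · refine h (insert v S) (by grind) (by simp)
      (fun s => if s = v then u else if R (σ s) (p s) s then p s else v)
      (fun s => if s = v then c else σ s) ?_ ?_
    · intro s hs
      grind
    · intro a ha b hb hab
      have key : ∀ s ∈ S, σ s ≠ c := fun s hs => (Finset.mem_erase.1 (hp s hs).2.1).1
      rw [Finset.mem_coe] at ha hb
      have := @hσ
      simp only [Set.InjOn, Finset.mem_coe] at this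
      grind
  · exact h S hSV hne p σ (by grind) hσ

lemma in_neighbor_unique_of_card_eq_three [DecidableEq α] (h : NoRainbow R C V)
    (hV : V.card = 3) (hin : ∀ c ∈ C, ∀ b ∈ V, ∃ a ∈ V, R c a b) {d d' : κ} (hd : d ∈ C)
    (hd' : d' ∈ C) (hdd : d ≠ d') {x y y' : α} (hx : x ∈ V) (hy : y ∈ V) (hy' : y' ∈ V)
    (hyx : R d y x) (hyx' : R d' y' x) : y = y' := by
  by_contra hne
  have hxy : x ≠ y := by
    rintro rfl
    exact h.not_loop hd hx hyx
  have hxy' : x ≠ y' := by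
    rintro rfl
    exact h.not_loop hd' hx hyx'
  have hVeq : {x, y, y'} = V :=
    Finset.eq_of_subset_of_card_le (by grind)
      (by rw [hV, Finset.card_eq_three.2 ⟨x, y, y', hxy, hxy', hne, rfl⟩])
  obtain ⟨a, ha, hay⟩ := hin d' hd' y hy
  obtain ⟨b, hb, hby⟩ := hin d hd y' hy'
  have hay' : a = y' := by
    rw [← hVeq] at ha
    simp only [Finset.mem_insert, Finset.mem_singleton] at ha
    rcases ha with rfl | rfl | rfl
    · exact absurd hyx (h.not_two_cycle hd' hd hdd.symm hx hy hay)
    · exact absurd hay (h.not_loop hd' hy)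
    · rfl
  have hby' : b = y := by
    rw [← hVeq] at hb
    simp only [Finset.mem_insert, Finset.mem_singleton] at hb
    rcases hb with rfl | rfl | rfl
    · exact absurd hyx' (h.not_two_cycle hd hd' hdd hx hy' hby)
    · rfl
    · exact absurd hby (h.not_loop hd hy')
  subst hay' hby'
  exact h.not_two_cycle hd' hd hdd.symm ha hb hay hby

/-- If every vertex has an in-edge of each of `|V| - 1` colours and there is no rainbow cycle,
then all in-edges at a vertex, of all colours, have the same source. -/
theorem in_neighbor_unique [DecidableEq α] [DecidableEq κ] (h : NoRainbow R C V)
    (hcard : C.card + 1 = V.card) (hin : ∀ c ∈ C, ∀ b ∈ V, ∃ a ∈ V, R c a b)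
    {d d' : κ} (hd : d ∈ C) (hd' : d' ∈ C) {x y y' : α} (hx : x ∈ V) (hy : y ∈ V)
    (hy' : y' ∈ V) (hyx : R d y x) (hyx' : R d' y' x) : y = y' := by
  induction hm : C.card generalizing R C V with
  | zero => simp_all
  | succ m ih =>
    by_contra hne
    have hxy : x ≠ y := by
      rintro rfl
      exact h.not_loop hd hx hyx
    have hxy' : x ≠ y' := by
      rintro rfl
      exact h.not_loop hd' hx hyx'
    have h3 : ({x, y, y'} : Finset α).card = 3 :=
      Finset.card_eq_three.2 ⟨x, y, y', hxy, hxy', hne, rfl⟩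
    have hsub : ({x, y, y'} : Finset α) ⊆ V := by grind
    have hle := Finset.card_le_card hsub
    rcases hle.eq_or_lt with heq | hlt
    · have hV : V.card = 3 := by omega
      by_cases hdd : d = d'
      · subst hdd
        obtain ⟨c, hc, hcd⟩ := Finset.exists_mem_ne (by omega : 1 < C.card) d
        obtain ⟨z, hz, hzx⟩ := hin c hc x hx
        have h1 := h.in_neighbor_unique_of_card_eq_three hV hin hc hd hcd hx hz hy hzx hyx
        have h2 := h.in_neighbor_unique_of_card_eq_three hV hin hc hd hcd hx hz hy' hzx hyx'
        exact hne (h1.symm.trans h2)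
      · exact hne (h.in_neighbor_unique_of_card_eq_three hV hin hd hd' hdd hx hy hy' hyx hyx')
    · obtain ⟨v, hv, hvn⟩ := Finset.exists_mem_notMem_of_card_lt_card hlt
      have hdd : ({d, d'} : Finset κ).card < C.card :=
        lt_of_le_of_lt Finset.card_le_two (by omega)
      obtain ⟨c, hc, hcn⟩ := Finset.exists_mem_notMem_of_card_lt_card hdd
      simp only [Finset.mem_insert, Finset.mem_singleton, not_or] at hvn hcn
      obtain ⟨u, hu, huv⟩ := hin c hc v hv
      have huv' : u ≠ v := by
        rintro rfl
        exact h.not_loop hc hu huv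
      refine hne (ih (h.contract hc hv huv) ?_ ?_ (by grind) (by grind) (by grind) (by grind)
        (by grind) (Or.inl hyx) (Or.inl hyx') ?_)
      · rw [Finset.card_erase_of_mem hc, Finset.card_erase_of_mem hv]
        omega
      · intro e he b hb
        obtain ⟨a, ha, hab⟩ := hin e (Finset.mem_of_mem_erase he) b (Finset.mem_of_mem_erase hb)
        by_cases hav : a = v
        · subst hav
          exact ⟨u, by grind, Or.inr ⟨rfl, hab⟩⟩
        · exact ⟨a, by grind, Or.inl hab⟩
      · rw [Finset.card_erase_of_mem hc]
        omega

end NoRainbow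

/-- A self-map of a nonempty finite set has a cycle, here traversed backwards. -/
lemma exists_cycle_of_mapsTo {α : Type*} {S : Finset α} (hS : S.Nonempty) {p : α → α}
    (hp : ∀ s ∈ S, p s ∈ S) :
    ∃ k : ℕ, 0 < k ∧ ∃ a : ZMod k → α, Function.Injective a ∧ (∀ t, a t ∈ S) ∧
      ∀ t, a t = p (a (t + 1)) := by
  obtain ⟨s, hs⟩ := hS
  have hmem : ∀ m, p^[m] s ∈ S := by
    intro m
    induction m with
    | zero => exact hs
    | succ m ih =>
      rw [Function.iterate_succ_apply']
      exact hp _ ih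
  obtain ⟨i, j, hij, heq⟩ : ∃ i j : ℕ, i < j ∧ p^[i] s = p^[j] s := by
    have hninj : ¬ Function.Injective fun m : ℕ => (⟨p^[m] s, hmem m⟩ : S) :=
      not_injective_infinite_finite _
    simp only [Function.Injective, not_forall] at hninj
    obtain ⟨i, j, hij, hne⟩ := hninj
    have hij' : p^[i] s = p^[j] s := congrArg Subtype.val hij
    rcases lt_or_gt_of_ne hne with hlt | hlt
    · exact ⟨i, j, hlt, hij'⟩
    · exact ⟨j, i, hlt, hij'.symm⟩
  set x := p^[i] s with hx
  have hper : x ∈ Function.periodicPts p := by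
    refine ⟨j - i, by omega, ?_⟩
    rw [Function.IsPeriodicPt, Function.IsFixedPt, hx, ← Function.iterate_add_apply,
      Nat.sub_add_cancel hij.le]
    exact heq.symm
  have hk := Function.minimalPeriod_pos_of_mem_periodicPts hper
  have : NeZero (Function.minimalPeriod p x) := ⟨hk.ne'⟩
  refine ⟨_, hk, fun t => p^[(-t).val] x, ?_, ?_, ?_⟩
  · intro t t' htt
    have := Function.iterate_injOn_Iio_minimalPeriod (ZMod.val_lt (-t)) (ZMod.val_lt (-t')) htt
    exact neg_injective (ZMod.val_injective _ this)
  · intro t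
    change p^[(-t).val] (p^[i] s) ∈ S
    rw [← Function.iterate_add_apply]
    exact hmem _
  · intro t
    change p^[(-t).val] x = p (p^[(-(t + 1)).val] x)
    rw [← Function.iterate_succ_apply' p,
      ← Function.iterate_mod_minimalPeriod_eq (n := (-(t + 1)).val.succ)]
    congr 2
    rw [← ZMod.val_natCast]
    congr 1
    simp

section ChampionGraph

variable {ι : Type*} [DecidableEq ι] {n : ℕ} {v : Fin n → Finset ι → ℝ} {X : Fin n → Finset ι}

/-- Every set envied by some agent has a most envious agent. -/
lemma exists_mostEnvious {i : Fin n} {S : Finset ι} (h : EnviesSet v X i S) :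
    ∃ j, MostEnvious v X j S := by
  classical
  obtain ⟨T, hT, hmin⟩ := Finset.exists_min_image
    (S.powerset.filter fun T => ∃ j, EnviesSet v X j T) Finset.card
    ⟨S, by simpa using ⟨i, h⟩⟩
  simp only [Finset.mem_filter, Finset.mem_powerset] at hT hmin
  obtain ⟨hTS, j, hj⟩ := hT
  refine ⟨j, T, hTS, hj, ?_⟩
  rintro l ⟨b, hb, hlt⟩
  have := hmin (T.erase b) ⟨(Finset.erase_subset _ _).trans hTS, l, hlt⟩
  exact absurd (Finset.card_erase_lt_of_mem hb) (not_lt.2 this)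

variable [Fintype ι]

lemma exists_champion (hval : ∀ i, IsValuation (v i)) (hnd : ∀ i, NonDegenerate (v i)) {g : ι}
    (hg : g ∈ unalloc X) (j : Fin n) : ∃ i, ChampG v X g i j := by
  have hgj : g ∉ X j := by
    simp only [unalloc, Finset.mem_sdiff, Finset.mem_biUnion, not_exists, not_and] at hg
    exact hg.2 j (Finset.mem_univ j)
  refine exists_mostEnvious (i := j) (lt_of_le_of_ne ((hval j).2.2 (Finset.subset_insert _ _)) ?_)
  exact hnd j _ _ (Finset.ne_insert_of_notMem _ _ hgj)

/-- A nonempty set of agents closed under a choice of in-edges in which every unallocated item is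
used at most once contains a basic PI cycle. -/
lemma nonempty_basicPICycle {S : Finset (Fin n)} (hS : S.Nonempty) (p : Fin n → Fin n)
    (lab : Fin n → Option ι) (hp : ∀ s ∈ S, p s ∈ S)
    (henvy : ∀ s ∈ S, lab s = none → EnviesSet v X (p s) (X s))
    (hchamp : ∀ s ∈ S, ∀ g, lab s = some g → g ∈ unalloc X ∧ ChampG v X g (p s) s)
    (honce : ∀ s ∈ S, ∀ t ∈ S, ∀ g, lab s = some g → lab t = some g → s = t) :
    Nonempty (BasicPICycle v X) := by
  obtain ⟨k, hk, a, hinj, hmem, hstep⟩ := exists_cycle_of_mapsTo hS hp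
  refine ⟨⟨k, hk, a, hinj, fun t => lab (a (t + 1)), ?_, ?_, ?_⟩⟩
  · intro t ht
    rw [hstep t]
    exact henvy _ (hmem _) ht
  · intro t g ht
    rw [hstep t]
    exact hchamp _ (hmem _) g ht
  · intro g t s ht hs
    exact add_right_cancel (hinj (honce _ (hmem _) _ (hmem _) g ht hs))

lemma noRainbow_champG (h : IsEmpty (BasicPICycle v X)) :
    NoRainbow (ChampG v X) (unalloc X) Finset.univ := by
  intro S _ hne p σ hp hσ
  refine not_nonempty_iff.2 h (nonempty_basicPICycle hne p (fun s => some (σ s))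
    (fun s hs => (hp s hs).1) (by simp) ?_ ?_)
  · rintro s hs g hg
    obtain rfl := Option.some.inj hg
    exact (hp s hs).2
  · intro s hs t ht g hsg htg
    exact hσ hs ht (Option.some.inj (hsg.trans htg.symm))

lemma card_unalloc_lt (hn : 0 < n) (hval : ∀ i, IsValuation (v i))
    (hnd : ∀ i, NonDegenerate (v i)) (h : IsEmpty (BasicPICycle v X)) :
    (unalloc X).card < n := by
  by_contra! hle
  obtain ⟨σ⟩ : Nonempty (Fin n ↪ unalloc X) :=
    Function.Embedding.nonempty_of_card_le (by simpa using hle)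
  choose p hp using fun j => exists_champion hval hnd (σ j).2 j
  exact noRainbow_champG h Finset.univ subset_rfl ⟨⟨0, hn⟩, Finset.mem_univ _⟩ p
    (fun j => σ j) (fun j _ => ⟨Finset.mem_univ _, (σ j).2, hp j⟩)
    (Subtype.val_injective.comp σ.injective).injOn

lemma not_enviesSet (hval : ∀ i, IsValuation (v i)) (hnd : ∀ i, NonDegenerate (v i))
    (hU : n - 1 ≤ (unalloc X).card) (h : IsEmpty (BasicPICycle v X)) (i j : Fin n) :
    ¬ EnviesSet v X i (X j) := by
  intro hij
  obtain ⟨σ⟩ : Nonempty ({s : Fin n // s ≠ j} ↪ unalloc X) :=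
    Function.Embedding.nonempty_of_card_le (by simpa [Fintype.card_subtype_compl] using hU)
  choose p hp using fun s : {s : Fin n // s ≠ j} => exists_champion hval hnd (σ s).2 s
  refine not_nonempty_iff.2 h (nonempty_basicPICycle (S := Finset.univ) ⟨j, Finset.mem_univ j⟩
    (fun s => if hs : s ≠ j then p ⟨s, hs⟩ else i)
    (fun s => if hs : s ≠ j then some (σ ⟨s, hs⟩ : ι) else none)
    (fun _ _ => Finset.mem_univ _) ?_ ?_ ?_)
  · intro s _ hs
    by_cases hsj : s = j
    · subst hsj
      simpa using hij
    · simp [hsj] at hs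
  · intro s _ g hs
    by_cases hsj : s = j
    · simp [hsj] at hs
    · simp only [ne_eq, hsj, not_false_eq_true, dite_true, Option.some.injEq] at hs ⊢
      subst hs
      exact ⟨(σ _).2, hp _⟩
  · intro s _ t _ g hs ht
    by_cases hsj : s = j
    · simp [hsj] at hs
    by_cases htj : t = j
    · simp [htj] at ht
    simp only [ne_eq, hsj, htj, not_false_eq_true, dite_true, Option.some.injEq] at hs ht
    exact congrArg Subtype.val (σ.injective (Subtype.ext (hs.trans ht.symm)))

/-- All champion edges into an agent, for all unallocated items, come from the same agent. -/
lemma exists_common_champion (hval : ∀ i, IsValuation (v i)) (hnd : ∀ i, NonDegenerate (v i))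
    (hcard : (unalloc X).card + 1 = n) (h : IsEmpty (BasicPICycle v X)) :
    ∃ f : Fin n → Fin n, ∀ g ∈ unalloc X, ∀ i j, ChampG v X g i j ↔ i = f j := by
  rcases (unalloc X).eq_empty_or_nonempty with hU | ⟨g₀, hg₀⟩
  · exact ⟨id, by simp [hU]⟩
  choose f hf using exists_champion hval hnd hg₀
  have huniq : ∀ g ∈ unalloc X, ∀ i j, ChampG v X g i j → i = f j := fun g hg i j hij =>
    (noRainbow_champG h).in_neighbor_unique (by simpa using hcard)
      (fun c hc b _ => by simpa using exists_champion hval hnd hc b) hg hg₀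
      (Finset.mem_univ j) (Finset.mem_univ i) (Finset.mem_univ _) hij (hf j)
  refine ⟨f, fun g hg i j => ⟨huniq g hg i j, ?_⟩⟩
  rintro rfl
  obtain ⟨i, hi⟩ := exists_champion hval hnd hg j
  exact huniq g hg i j hi ▸ hi

end ChampionGraph

/-- If `X` is a partial EFX allocation for `n` agents with
non-degenerate cancelable valuations with at least `n - 1` unallocated items and
the basic champion graph contains no basic PI cycle, then there are exactly
`n - 1` unallocated items, there are no envy edges, and there is a single cyclic
ordering of the agents such that for every unallocated item `g` the `g`-champion
edges are exactly the `n` successor edges of this cyclic ordering. -/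
theorem parallel_hamiltonian_cycles
    {ι : Type*} [DecidableEq ι] [Fintype ι] {n : ℕ} (hn : 0 < n)
    (v : Fin n → Finset ι → ℝ) (hval : ∀ i, IsValuation (v i))
    (hnd : ∀ i, NonDegenerate (v i)) (hc : ∀ i, Cancelable (v i))
    (X : Fin n → Finset ι) (hX : IsPartialAlloc X) (hEFX : IsEFX v X)
    (hU : n - 1 ≤ (unalloc X).card)
    (hnoPI : IsEmpty (BasicPICycle v X)) :
    (unalloc X).card = n - 1 ∧
    (∀ i j : Fin n, i ≠ j → ¬ EnviesSet v X i (X j)) ∧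
    ∃ e : ZMod n ≃ Fin n, ∀ g ∈ unalloc X, ∀ i j : Fin n,
      ChampG v X g i j ↔ ∃ t : ZMod n, e t = i ∧ e (t + 1) = j := by
  have hlt := card_unalloc_lt hn hval hnd hnoPI
  have hcard : (unalloc X).card + 1 = n := by omega
  refine ⟨by omega, fun i j _ => not_enviesSet hval hnd hU hnoPI i j, ?_⟩
  obtain ⟨f, hf⟩ := exists_common_champion hval hnd hcard hnoPI
  obtain ⟨k, hk, a, hinj, -, hstep⟩ := exists_cycle_of_mapsTo (S := Finset.univ)
    ⟨⟨0, hn⟩, Finset.mem_univ _⟩ (p := f) (fun _ _ => Finset.mem_univ _)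
  have : NeZero k := ⟨hk.ne'⟩
  have hkn : k ≤ n := by simpa using Fintype.card_le_of_injective a hinj
  obtain rfl : k = n := by
    by_contra hne
    obtain ⟨σ⟩ : Nonempty (ZMod k ↪ unalloc X) :=
      Function.Embedding.nonempty_of_card_le (by simpa using (by omega : k ≤ (unalloc X).card))
    refine noRainbow_champG hnoPI (Finset.univ.image a) (Finset.subset_univ _)
      ⟨a 0, by simp⟩ f (fun s => σ (Function.invFun a s)) ?_ ?_
    · intro s hs
      obtain ⟨t, -, rfl⟩ := Finset.mem_image.1 hs
      refine ⟨?_, (σ _).2, (hf _ (σ _).2 _ _).2 rfl⟩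
      rw [← sub_add_cancel t 1, ← hstep]
      simp
    · intro s hs s' hs' hss
      obtain ⟨t, -, rfl⟩ := Finset.mem_image.1 hs
      obtain ⟨t', -, rfl⟩ := Finset.mem_image.1 hs'
      have := σ.injective (Subtype.ext hss)
      simp only [Function.leftInverse_invFun hinj _] at this
      rw [this]
  have hbij : Function.Bijective a :=
    (Fintype.bijective_iff_injective_and_card a).2 ⟨hinj, by simp⟩
  refine ⟨Equiv.ofBijective a hbij, fun g hg i j => ?_⟩
  simp only [hf g hg, Equiv.ofBijective_apply]
  constructor
  · rintro rfl
    obtain ⟨t, rfl⟩ := hbij.surjective j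
    exact ⟨t - 1, by rw [hstep, sub_add_cancel], by rw [sub_add_cancel]⟩
  · rintro ⟨t, rfl, rfl⟩
    exact hstep t

end FairDivision
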